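/- (Existence theorem, Perron's method.) Let the system F_j(x,u(x),Du_j(x),D²u_j(x)) = 0, j = 1,…,m₁+m₂, be degenerate elliptic and balanced quasi-monotone. Suppose there exist a bounded super-sub solution (z₁,z₂) and a bounded sub-super solution (w₁,w₂) of the system such that z₁ ≥ w₁ in Ω and z₂ ≤ w₂ in Ω (componentwise). Then there exists a solution (u₁,u₂) of the system such that z₁ ≥ u₁ ≥ w₁ and z₂ ≤ u₂ ≤ w₂ in Ω. -/

import Mathlib

open Filter Topology Matrix Bornology

noncomputable section

/-- Euclidean space ℝⁿ. -/
abbrev En (n : ℕ) := EuclideanSpace ℝ (Fin n)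

/-- n×n real matrices (the symmetric ones model 𝒮ⁿ). -/
abbrev Symn (n : ℕ) := Matrix (Fin n) (Fin n) ℝ

/-- Loewner order: `X ≤ Y` iff `Y - X` is positive semidefinite. -/
def LoewnerLE {ι : Type*} [Fintype ι] (X Y : Matrix ι ι ℝ) : Prop := (Y - X).PosSemidef

/-- Upper semicontinuous envelope relative to Ω: f*(x) = limsup_{Ω ∋ y → x} f(y). -/
def uEnv {n : ℕ} (Ω : Set (En n)) (f : En n → ℝ) (x : En n) : ℝ := limsup f (𝓝[Ω] x)

/-- Lower semicontinuous envelope relative to Ω: f_*(x) = liminf_{Ω ∋ y → x} f(y). -/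
def lEnv {n : ℕ} (Ω : Set (En n)) (f : En n → ℝ) (x : En n) : ℝ := liminf f (𝓝[Ω] x)

/-- φ touches f from above at x (within Ω). -/
def TouchAbove {n : ℕ} (Ω : Set (En n)) (φ f : En n → ℝ) (x : En n) : Prop :=
  φ x = f x ∧ ∃ N : Set (En n), IsOpen N ∧ x ∈ N ∧ ∀ y ∈ (N ∩ Ω) \ {x}, f y < φ y

/-- φ touches f from below at x (within Ω). -/
def TouchBelow {n : ℕ} (Ω : Set (En n)) (φ f : En n → ℝ) (x : En n) : Prop :=
  φ x = f x ∧ ∃ N : Set (En n), IsOpen N ∧ x ∈ N ∧ ∀ y ∈ (N ∩ Ω) \ {x}, φ y < f y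

/-- Hessian matrix D²φ(x) of a scalar function. -/
def hess {n : ℕ} (φ : En n → ℝ) (x : En n) : Symn n :=
  Matrix.of fun i j =>
    iteratedFDeriv ℝ 2 φ x ![EuclideanSpace.single i 1, EuclideanSpace.single j 1]

/-- The type of the operators F_j(x, r, s, p, X). -/
abbrev Op (n m₁ m₂ : ℕ) :=
  En n → (Fin m₁ → ℝ) → (Fin m₂ → ℝ) → En n → Symn n → ℝ

/-- Continuity of an operator on Ω × ℝ^{m₁} × ℝ^{m₂} × ℝⁿ × 𝒮ⁿ. -/
def OpContinuousOn {n m₁ m₂ : ℕ} (Ω : Set (En n)) (F : Op n m₁ m₂) : Prop :=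
  ContinuousOn (fun q : En n × (Fin m₁ → ℝ) × (Fin m₂ → ℝ) × En n × Symn n =>
      F q.1 q.2.1 q.2.2.1 q.2.2.2.1 q.2.2.2.2)
    (Ω ×ˢ (Set.univ : Set ((Fin m₁ → ℝ) × (Fin m₂ → ℝ) × En n × Symn n)))

/-- Degenerate ellipticity of an operator. -/
def DegElliptic {n m₁ m₂ : ℕ} (Ω : Set (En n)) (F : Op n m₁ m₂) : Prop :=
  ∀ x ∈ Ω, ∀ (r : Fin m₁ → ℝ) (s : Fin m₂ → ℝ) (p : En n) (X Y : Symn n),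
    X.IsSymm → Y.IsSymm → LoewnerLE X Y → F x r s p Y ≤ F x r s p X

/-- Balanced quasi-monotonicity of the system (F1, F2). -/
def BalancedQM {n m₁ m₂ : ℕ} (Ω : Set (En n))
    (F1 : Fin m₁ → Op n m₁ m₂) (F2 : Fin m₂ → Op n m₁ m₂) : Prop :=
  (∀ j, ∀ x ∈ Ω, ∀ (r : Fin m₁ → ℝ) (s σ : Fin m₂ → ℝ) (p : En n) (X : Symn n), X.IsSymm →
      (∀ i, s i ≤ σ i) → F1 j x r s p X ≤ F1 j x r σ p X) ∧
  (∀ j, ∀ x ∈ Ω, ∀ (r ρ : Fin m₁ → ℝ) (s : Fin m₂ → ℝ) (p : En n) (X : Symn n), X.IsSymm →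
      (∀ i, r i ≤ ρ i) → r j = ρ j → F1 j x ρ s p X ≤ F1 j x r s p X) ∧
  (∀ j, ∀ x ∈ Ω, ∀ (r ρ : Fin m₁ → ℝ) (s : Fin m₂ → ℝ) (p : En n) (X : Symn n), X.IsSymm →
      (∀ i, r i ≤ ρ i) → F2 j x r s p X ≤ F2 j x ρ s p X) ∧
  (∀ j, ∀ x ∈ Ω, ∀ (r : Fin m₁ → ℝ) (s σ : Fin m₂ → ℝ) (p : En n) (X : Symn n), X.IsSymm →
      (∀ i, s i ≤ σ i) → s j = σ j → F2 j x r σ p X ≤ F2 j x r s p X)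

/-- Boundedness of a vector-valued function on Ω. -/
def BddOn {n m : ℕ} (Ω : Set (En n)) (u : En n → Fin m → ℝ) : Prop :=
  ∃ M : ℝ, ∀ x ∈ Ω, ∀ i, |u x i| ≤ M

/-- (u1, u2) is a super-sub solution of the system (F1, F2) in Ω. -/
def SuperSub {n m₁ m₂ : ℕ} (Ω : Set (En n))
    (F1 : Fin m₁ → Op n m₁ m₂) (F2 : Fin m₂ → Op n m₁ m₂)
    (u1 : En n → Fin m₁ → ℝ) (u2 : En n → Fin m₂ → ℝ) : Prop :=
  BddOn Ω u1 ∧ BddOn Ω u2 ∧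
  (∀ j, ∀ x ∈ Ω, ∀ φ : En n → ℝ, ContDiff ℝ 2 φ →
      TouchBelow Ω φ (lEnv Ω fun y => u1 y j) x →
      0 ≤ F1 j x (fun i => lEnv Ω (fun y => u1 y i) x) (fun i => uEnv Ω (fun y => u2 y i) x)
            (gradient φ x) (hess φ x)) ∧
  (∀ j, ∀ x ∈ Ω, ∀ φ : En n → ℝ, ContDiff ℝ 2 φ →
      TouchAbove Ω φ (uEnv Ω fun y => u2 y j) x →
      F2 j x (fun i => lEnv Ω (fun y => u1 y i) x) (fun i => uEnv Ω (fun y => u2 y i) x)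
          (gradient φ x) (hess φ x) ≤ 0)

/-- (u1, u2) is a sub-super solution of the system (F1, F2) in Ω. -/
def SubSuper {n m₁ m₂ : ℕ} (Ω : Set (En n))
    (F1 : Fin m₁ → Op n m₁ m₂) (F2 : Fin m₂ → Op n m₁ m₂)
    (u1 : En n → Fin m₁ → ℝ) (u2 : En n → Fin m₂ → ℝ) : Prop :=
  BddOn Ω u1 ∧ BddOn Ω u2 ∧
  (∀ j, ∀ x ∈ Ω, ∀ φ : En n → ℝ, ContDiff ℝ 2 φ →
      TouchAbove Ω φ (uEnv Ω fun y => u1 y j) x →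
      F1 j x (fun i => uEnv Ω (fun y => u1 y i) x) (fun i => lEnv Ω (fun y => u2 y i) x)
          (gradient φ x) (hess φ x) ≤ 0) ∧
  (∀ j, ∀ x ∈ Ω, ∀ φ : En n → ℝ, ContDiff ℝ 2 φ →
      TouchBelow Ω φ (lEnv Ω fun y => u2 y j) x →
      0 ≤ F2 j x (fun i => uEnv Ω (fun y => u1 y i) x) (fun i => lEnv Ω (fun y => u2 y i) x)
            (gradient φ x) (hess φ x))

section Calculus

variable {n : ℕ}

lemma hess_apply (φ : En n → ℝ) (x : En n) (i j : Fin n) :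
    hess φ x i j =
      fderiv ℝ (fderiv ℝ φ) x (EuclideanSpace.single i 1) (EuclideanSpace.single j 1) := by
  simp [hess, iteratedFDeriv_two_apply]

lemma hess_isSymm {φ : En n → ℝ} (hφ : ContDiff ℝ 2 φ) (x : En n) : (hess φ x).IsSymm := by
  ext i j
  have h : IsSymmSndFDerivAt ℝ φ x := hφ.contDiffAt.isSymmSndFDerivAt (by simp)
  simp only [Matrix.transpose_apply, hess_apply]
  exact h _ _

lemma continuous_gradient {φ : En n → ℝ} (hφ : ContDiff ℝ 2 φ) :
    Continuous fun x => gradient φ x :=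
  (InnerProductSpace.toDual ℝ (En n)).symm.continuous.comp (hφ.continuous_fderiv (by simp))

lemma differentiable_fderiv {φ : En n → ℝ} (hφ : ContDiff ℝ 2 φ) :
    Differentiable ℝ (fderiv ℝ φ) :=
  (hφ.fderiv_right (m := 1) (by norm_num)).differentiable (by simp)

lemma continuous_hess {φ : En n → ℝ} (hφ : ContDiff ℝ 2 φ) : Continuous fun x => hess φ x := by
  refine continuous_matrix fun i j => ?_
  simp only [hess_apply]
  have h : Continuous (fderiv ℝ (fderiv ℝ φ)) :=
    (hφ.fderiv_right (m := 1) (by norm_num)).continuous_fderiv (by simp)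
  exact (h.clm_apply continuous_const).clm_apply continuous_const

lemma gradient_neg_fun (φ : En n → ℝ) (x : En n) :
    gradient (fun y => -φ y) x = -gradient φ x := by
  simp [gradient, fderiv_fun_neg]

lemma hess_neg_fun (φ : En n → ℝ) (x : En n) : hess (fun y => -φ y) x = -hess φ x := by
  ext i j
  have h : fderiv ℝ (fun y => -φ y) = -fderiv ℝ φ := by
    ext1 y; simp [fderiv_fun_neg]
  simp [hess_apply, h, fderiv_neg]

lemma hasFDerivAt_quartic (a y : En n) :
    HasFDerivAt (fun y : En n => (‖y - a‖ ^ 2) ^ 2)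
      ((4 * ‖y - a‖ ^ 2) • innerSL ℝ (y - a)) y := by
  have h := (((hasFDerivAt_id y).sub_const a).norm_sq).pow 2
  refine h.congr_fderiv ?_
  ext v
  simp
  ring

lemma hasFDerivAt_fderiv_quartic (a : En n) :
    HasFDerivAt (fun y : En n => (4 * ‖y - a‖ ^ 2) • (innerSL ℝ (y - a) : En n →L[ℝ] ℝ))
      (0 : En n →L[ℝ] En n →L[ℝ] ℝ) a := by
  refine Asymptotics.IsBigO.hasFDerivAt (n := 3) (Asymptotics.IsBigO.of_bound 4 ?_) (by norm_num)
  refine Eventually.of_forall fun y => le_of_eq ?_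
  rw [norm_smul, innerSL_apply_norm, norm_mul, norm_pow, norm_pow, norm_norm]
  norm_num
  ring

lemma contDiff_add_quartic {φ : En n → ℝ} (hφ : ContDiff ℝ 2 φ) (a : En n) (c s : ℝ) :
    ContDiff ℝ 2 fun y => φ y + c + s * (‖y - a‖ ^ 2) ^ 2 :=
  (hφ.add contDiff_const).add
    (contDiff_const.mul (((contDiff_id.sub contDiff_const).norm_sq ℝ).pow 2))

lemma fderiv_add_quartic {φ : En n → ℝ} (hφ : ContDiff ℝ 2 φ) (a : En n) (c s : ℝ) :
    fderiv ℝ (fun y => φ y + c + s * (‖y - a‖ ^ 2) ^ 2) =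
      fun y => fderiv ℝ φ y + s • ((4 * ‖y - a‖ ^ 2) • innerSL ℝ (y - a)) := by
  ext1 y
  have h := (hφ.differentiable (by simp) y).hasFDerivAt
  exact ((h.add_const c).add ((hasFDerivAt_quartic a y).const_mul s)).fderiv

lemma gradient_add_quartic {φ : En n → ℝ} (hφ : ContDiff ℝ 2 φ) (a : En n) (c s : ℝ) :
    gradient (fun y => φ y + c + s * (‖y - a‖ ^ 2) ^ 2) a = gradient φ a := by
  simp [gradient, fderiv_add_quartic hφ a c s]

lemma hess_add_quartic {φ : En n → ℝ} (hφ : ContDiff ℝ 2 φ) (a : En n) (c s : ℝ) :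
    hess (fun y => φ y + c + s * (‖y - a‖ ^ 2) ^ 2) a = hess φ a := by
  have h := (differentiable_fderiv hφ a).hasFDerivAt
  have h2 := (h.add ((hasFDerivAt_fderiv_quartic a).const_smul s)).fderiv
  ext i j
  rw [hess_apply, hess_apply, fderiv_add_quartic hφ a c s]
  erw [h2]
  simp

/-- Second order necessary condition at a local minimum of a function of one variable. -/
lemma deriv_deriv_nonneg_of_isLocalMin {g : ℝ → ℝ} {t : ℝ} (hg : ContinuousAt g t)
    (h : IsLocalMin g t) : 0 ≤ deriv (deriv g) t := by
  by_contra! hneg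
  have hmax := isLocalMax_of_deriv_deriv_neg hneg h.deriv_eq_zero hg
  have hc : g =ᶠ[𝓝 t] fun _ => g t := by
    filter_upwards [h, hmax] with y h1 h2 using le_antisymm h2 h1
  have hd : deriv g =ᶠ[𝓝 t] fun _ => 0 := by simpa using hc.deriv
  simp [hd.deriv_eq] at hneg

/-- Second order necessary condition at a local minimum. -/
lemma fderiv_fderiv_nonneg_of_isLocalMin {g : En n → ℝ} (hg : ContDiff ℝ 2 g) {x : En n}
    (h : IsLocalMin g x) (v : En n) : 0 ≤ fderiv ℝ (fderiv ℝ g) x v v := by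
  have hl : ∀ t : ℝ, HasDerivAt (fun t : ℝ => x + t • v) v t := fun t => by
    simpa using ((hasDerivAt_id t).smul_const v).const_add x
  have hd : ∀ t : ℝ, HasDerivAt (fun t : ℝ => g (x + t • v)) (fderiv ℝ g (x + t • v) v) t :=
    fun t => (hg.differentiable (by simp) _).hasFDerivAt.comp_hasDerivAt t (hl t)
  have hd2 : HasDerivAt (fun t : ℝ => fderiv ℝ g (x + t • v) v)
      (fderiv ℝ (fderiv ℝ g) x v v) 0 := by
    have h1 : HasFDerivAt (fderiv ℝ g) (fderiv ℝ (fderiv ℝ g) x) (x + (0 : ℝ) • v) := by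
      simpa using (differentiable_fderiv hg x).hasFDerivAt
    have h2 := h1.comp_hasDerivAt (0 : ℝ) (hl 0)
    simpa using h2.clm_apply (hasDerivAt_const (0 : ℝ) v)
  have hm : IsLocalMin (fun t : ℝ => g (x + t • v)) 0 := by
    have hc : Tendsto (fun t : ℝ => x + t • v) (𝓝 0) (𝓝 x) := by
      simpa using (hl 0).continuousAt.tendsto
    simpa [IsLocalMin, IsMinFilter] using hc.eventually h
  have := deriv_deriv_nonneg_of_isLocalMin (hd 0).continuousAt hm
  rwa [show deriv (fun t : ℝ => g (x + t • v)) = fun t => fderiv ℝ g (x + t • v) v from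
    funext fun t => (hd t).deriv, hd2.deriv] at this

lemma gradient_eq_of_isLocalMin_sub {φ ψ : En n → ℝ} (hφ : ContDiff ℝ 2 φ)
    (hψ : ContDiff ℝ 2 ψ) {x : En n} (h : IsLocalMin (fun y => ψ y - φ y) x) :
    gradient ψ x = gradient φ x := by
  have h0 := h.fderiv_eq_zero
  rw [fderiv_fun_sub (hψ.differentiable (by simp) x) (hφ.differentiable (by simp) x)] at h0
  rw [gradient, gradient, sub_eq_zero.1 h0]

lemma hess_loewnerLE_of_isLocalMin_sub {φ ψ : En n → ℝ} (hφ : ContDiff ℝ 2 φ)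
    (hψ : ContDiff ℝ 2 ψ) {x : En n} (h : IsLocalMin (fun y => ψ y - φ y) x) :
    LoewnerLE (hess φ x) (hess ψ x) := by
  have hs : ∀ M : Symn n, M.IsSymm → M.IsHermitian := fun M hM => by
    rwa [Matrix.IsHermitian, Matrix.conjTranspose_eq_transpose_of_trivial]
  refine Matrix.PosSemidef.of_dotProduct_mulVec_nonneg
    ((hs _ (hess_isSymm hψ x)).sub (hs _ (hess_isSymm hφ x))) fun v => ?_
  have h1 := fderiv_fderiv_nonneg_of_isLocalMin (hψ.sub hφ) h (WithLp.toLp 2 v)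
  have h2 : fderiv ℝ (fderiv ℝ fun y => ψ y - φ y) x =
      fderiv ℝ (fderiv ℝ ψ) x - fderiv ℝ (fderiv ℝ φ) x := by
    rw [← fderiv_sub (differentiable_fderiv hψ x) (differentiable_fderiv hφ x)]
    congr 1
    ext1 y
    exact fderiv_fun_sub (hψ.differentiable (by simp) y) (hφ.differentiable (by simp) y)
  have h3 : (WithLp.toLp 2 v : En n) = ∑ i, v i • EuclideanSpace.single i (1 : ℝ) := by
    ext k
    simp [Finset.sum_apply, Pi.single_apply]
  rw [h2, h3] at h1
  refine h1.trans_eq ?_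
  simp only [map_sum, map_smul, _root_.sum_apply, _root_.smul_apply,
    dotProduct, Matrix.mulVec, Matrix.sub_apply, hess_apply, star_trivial, Finset.mul_sum,
    _root_.sub_apply, smul_eq_mul]
  rw [Finset.sum_comm]
  refine Finset.sum_congr rfl fun i _ => Finset.sum_congr rfl fun j _ => ?_
  ring

end Calculus

section Envelope

variable {n : ℕ} {Ω : Set (En n)}

lemma uEnv_eq_limsup (hΩ : IsOpen Ω) {x : En n} (hx : x ∈ Ω) (f : En n → ℝ) :
    uEnv Ω f x = limsup f (𝓝 x) := by
  rw [uEnv, hΩ.nhdsWithin_eq hx]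

lemma lEnv_eq_neg_uEnv (Ω : Set (En n)) (f : En n → ℝ) (x : En n) :
    lEnv Ω f x = -uEnv Ω (fun y => -f y) x := by
  rw [lEnv, uEnv, liminf_eq, limsup_eq, ← Real.sSup_neg]
  congr 1
  ext a
  simp

lemma uEnv_congr (hΩ : IsOpen Ω) {x : En n} (hx : x ∈ Ω) {f g : En n → ℝ} (h : f =ᶠ[𝓝 x] g) :
    uEnv Ω f x = uEnv Ω g x := by
  rw [uEnv_eq_limsup hΩ hx, uEnv_eq_limsup hΩ hx, limsup_congr h]

variable {f g : En n → ℝ} {M M' : ℝ}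

lemma isBoundedUnder_of_abs_le (hΩ : IsOpen Ω) {x : En n} (hx : x ∈ Ω)
    (hf : ∀ y ∈ Ω, |f y| ≤ M) : IsBoundedUnder (· ≤ ·) (𝓝 x) f :=
  isBoundedUnder_of_eventually_le (a := M) <| by
    filter_upwards [hΩ.mem_nhds hx] with y hy using (abs_le.1 (hf y hy)).2

lemma isCoboundedUnder_of_abs_le (hΩ : IsOpen Ω) {x : En n} (hx : x ∈ Ω)
    (hf : ∀ y ∈ Ω, |f y| ≤ M) : IsCoboundedUnder (· ≤ ·) (𝓝 x) f :=
  isCoboundedUnder_le_of_eventually_le (x := -M) _ <| by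
    filter_upwards [hΩ.mem_nhds hx] with y hy using (abs_le.1 (hf y hy)).1

lemma le_uEnv (hΩ : IsOpen Ω) (hf : ∀ y ∈ Ω, |f y| ≤ M) {x : En n} (hx : x ∈ Ω) :
    f x ≤ uEnv Ω f x := by
  rw [uEnv_eq_limsup hΩ hx]
  refine le_limsup_of_frequently_le ?_ (isBoundedUnder_of_abs_le hΩ hx hf)
  exact fun h => h.self_of_nhds le_rfl

lemma uEnv_mono (hΩ : IsOpen Ω) (hf : ∀ y ∈ Ω, |f y| ≤ M) (hg : ∀ y ∈ Ω, |g y| ≤ M')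
    (hfg : ∀ y ∈ Ω, f y ≤ g y) {x : En n} (hx : x ∈ Ω) : uEnv Ω f x ≤ uEnv Ω g x := by
  rw [uEnv_eq_limsup hΩ hx, uEnv_eq_limsup hΩ hx]
  refine limsup_le_limsup ?_ (isCoboundedUnder_of_abs_le hΩ hx hf)
    (isBoundedUnder_of_abs_le hΩ hx hg)
  filter_upwards [hΩ.mem_nhds hx] with y hy using hfg y hy

lemma eventually_lt_of_uEnv_lt (hΩ : IsOpen Ω) (hf : ∀ y ∈ Ω, |f y| ≤ M) {x : En n}
    (hx : x ∈ Ω) {a : ℝ} (h : uEnv Ω f x < a) : ∀ᶠ y in 𝓝 x, f y < a := by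
  rw [uEnv_eq_limsup hΩ hx] at h
  exact eventually_lt_of_limsup_lt h (isBoundedUnder_of_abs_le hΩ hx hf)

lemma eventually_uEnv_lt (hΩ : IsOpen Ω) (hf : ∀ y ∈ Ω, |f y| ≤ M) {x : En n}
    (hx : x ∈ Ω) {a : ℝ} (h : uEnv Ω f x < a) : ∀ᶠ y in 𝓝 x, uEnv Ω f y < a := by
  obtain ⟨b, hb, hba⟩ := exists_between h
  filter_upwards [(eventually_lt_of_uEnv_lt hΩ hf hx hb).eventually_nhds, hΩ.mem_nhds hx]
    with y hy hyΩ
  rw [uEnv_eq_limsup hΩ hyΩ]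
  exact (limsup_le_of_le (isCoboundedUnder_of_abs_le hΩ hyΩ hf)
    (hy.mono fun _ h => h.le)).trans_lt hba

lemma frequently_lt_of_lt_uEnv (hΩ : IsOpen Ω) (hf : ∀ y ∈ Ω, |f y| ≤ M) {x : En n}
    (hx : x ∈ Ω) {a : ℝ} (h : a < uEnv Ω f x) : ∃ᶠ y in 𝓝 x, a < f y := by
  rw [uEnv_eq_limsup hΩ hx] at h
  exact frequently_lt_of_lt_limsup (isCoboundedUnder_of_abs_le hΩ hx hf) h

lemma uEnv_max (hΩ : IsOpen Ω) (hf : ∀ y ∈ Ω, |f y| ≤ M) {x : En n} (hx : x ∈ Ω)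
    (hg : ContinuousAt g x) : uEnv Ω (fun y => max (f y) (g y)) x = max (uEnv Ω f x) (g x) := by
  rw [uEnv_eq_limsup hΩ hx, uEnv_eq_limsup hΩ hx,
    limsup_max (isCoboundedUnder_of_abs_le hΩ hx hf) hg.tendsto.isCoboundedUnder_le
      (isBoundedUnder_of_abs_le hΩ hx hf) hg.tendsto.isBoundedUnder_le, hg.tendsto.limsup_eq]

lemma lEnv_le (hΩ : IsOpen Ω) (hf : ∀ y ∈ Ω, |f y| ≤ M) {x : En n} (hx : x ∈ Ω) :
    lEnv Ω f x ≤ f x := by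
  have := le_uEnv (f := fun y => -f y) hΩ (by simpa using hf) hx
  rw [lEnv_eq_neg_uEnv]
  linarith

lemma lEnv_mono (hΩ : IsOpen Ω) (hf : ∀ y ∈ Ω, |f y| ≤ M) (hg : ∀ y ∈ Ω, |g y| ≤ M')
    (hfg : ∀ y ∈ Ω, f y ≤ g y) {x : En n} (hx : x ∈ Ω) : lEnv Ω f x ≤ lEnv Ω g x := by
  rw [lEnv_eq_neg_uEnv, lEnv_eq_neg_uEnv]
  exact neg_le_neg (uEnv_mono (M := M') (M' := M) hΩ (by simpa using hg) (by simpa using hf)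
    (by simpa using hfg) hx)

lemma eventually_lt_of_lt_lEnv (hΩ : IsOpen Ω) (hf : ∀ y ∈ Ω, |f y| ≤ M) {x : En n}
    (hx : x ∈ Ω) {a : ℝ} (h : a < lEnv Ω f x) : ∀ᶠ y in 𝓝 x, a < f y := by
  rw [lEnv_eq_neg_uEnv, lt_neg] at h
  simpa using eventually_lt_of_uEnv_lt (f := fun y => -f y) hΩ (by simpa using hf) hx h

lemma frequently_lt_of_lEnv_lt (hΩ : IsOpen Ω) (hf : ∀ y ∈ Ω, |f y| ≤ M) {x : En n}
    (hx : x ∈ Ω) {a : ℝ} (h : lEnv Ω f x < a) : ∃ᶠ y in 𝓝 x, f y < a := by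
  rw [lEnv_eq_neg_uEnv, neg_lt] at h
  simpa using frequently_lt_of_lt_uEnv (f := fun y => -f y) hΩ (by simpa using hf) hx h

end Envelope

section System

variable {n : ℕ} {ι : Type*} {Ω : Set (En n)}
  {G : ι → En n → (ι → ℝ) → En n → Symn n → ℝ}

/-- Viscosity subsolutions of the system `G i x u (Du_i) (D²u_i) = 0`. -/
def SysSub (Ω : Set (En n)) (G : ι → En n → (ι → ℝ) → En n → Symn n → ℝ) (u : En n → ι → ℝ) :
    Prop :=
  ∀ j, ∀ x ∈ Ω, ∀ φ : En n → ℝ, ContDiff ℝ 2 φ → TouchAbove Ω φ (uEnv Ω fun y => u y j) x →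
    G j x (fun i => uEnv Ω (fun y => u y i) x) (gradient φ x) (hess φ x) ≤ 0

/-- Viscosity supersolutions of the system `G i x u (Du_i) (D²u_i) = 0`. -/
def SysSuper (Ω : Set (En n)) (G : ι → En n → (ι → ℝ) → En n → Symn n → ℝ) (u : En n → ι → ℝ) :
    Prop :=
  ∀ j, ∀ x ∈ Ω, ∀ φ : En n → ℝ, ContDiff ℝ 2 φ → TouchBelow Ω φ (lEnv Ω fun y => u y j) x →
    0 ≤ G j x (fun i => lEnv Ω (fun y => u y i) x) (gradient φ x) (hess φ x)

/-- Joint continuity of the equations of a system. -/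
def SysContinuous (Ω : Set (En n)) (G : ι → En n → (ι → ℝ) → En n → Symn n → ℝ) : Prop :=
  ∀ j, ContinuousOn (fun q : En n × (ι → ℝ) × En n × Symn n => G j q.1 q.2.1 q.2.2.1 q.2.2.2)
    (Ω ×ˢ Set.univ)

/-- Degenerate ellipticity of a system. -/
def SysElliptic (Ω : Set (En n)) (G : ι → En n → (ι → ℝ) → En n → Symn n → ℝ) : Prop :=
  ∀ j, ∀ x ∈ Ω, ∀ r p (X Y : Symn n), X.IsSymm → Y.IsSymm → LoewnerLE X Y →
    G j x r p Y ≤ G j x r p X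

/-- Quasi-monotonicity of a system: each equation is nonincreasing in the other unknowns. -/
def SysQuasiMonotone (Ω : Set (En n)) (G : ι → En n → (ι → ℝ) → En n → Symn n → ℝ) : Prop :=
  ∀ j, ∀ x ∈ Ω, ∀ (r ρ : ι → ℝ) p (X : Symn n), X.IsSymm → (∀ i, r i ≤ ρ i) → r j = ρ j →
    G j x ρ p X ≤ G j x r p X

lemma SysContinuous.exists_ball [Fintype ι] (hG : SysContinuous Ω G) (hΩ : IsOpen Ω) (j : ι) {x : En n}
    (hx : x ∈ Ω) {φ : En n → ℝ} (hφ : ContDiff ℝ 2 φ) (r₀ : ι → ℝ) {s : Set ℝ} (hs : IsOpen s)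
    (h : G j x r₀ (gradient φ x) (hess φ x) ∈ s) :
    ∃ ε > 0, ∀ y, dist y x < ε → ∀ r : ι → ℝ, (∀ i, |r i - r₀ i| < ε) →
      G j y r (gradient φ y) (hess φ y) ∈ s := by
  have hT : ContinuousAt (fun q : En n × (ι → ℝ) =>
      G j q.1 q.2 (gradient φ q.1) (hess φ q.1)) (x, r₀) := by
    have h1 := (hG j).continuousAt (x := (x, r₀, gradient φ x, hess φ x))
      ((hΩ.prod isOpen_univ).mem_nhds ⟨hx, trivial⟩)
    have h2 : Continuous fun q : En n × (ι → ℝ) => (q.1, q.2, gradient φ q.1, hess φ q.1) :=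
      continuous_fst.prodMk (continuous_snd.prodMk
        (((continuous_gradient hφ).comp continuous_fst).prodMk
          ((continuous_hess hφ).comp continuous_fst)))
    exact ContinuousAt.comp (f := fun q : En n × (ι → ℝ) =>
      (q.1, q.2, gradient φ q.1, hess φ q.1)) (x := (x, r₀)) h1 h2.continuousAt
  obtain ⟨ε, hε, hb⟩ := Metric.eventually_nhds_iff.1 (hT.eventually (hs.mem_nhds h))
  refine ⟨ε, hε, fun y hy r hr => hb (y := (y, r)) ?_⟩
  rw [Prod.dist_eq, max_lt_iff]
  exact ⟨hy, (dist_pi_lt_iff hε).2 fun i => by simpa [Real.dist_eq] using hr i⟩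

lemma SysSub.le_zero_of_isLocalMax {u : En n → ι → ℝ} (hu : SysSub Ω G u) {j : ι} {x : En n}
    (hx : x ∈ Ω) {φ : En n → ℝ} (hφ : ContDiff ℝ 2 φ)
    (h : IsLocalMax (fun y => uEnv Ω (fun y => u y j) y - φ y) x) :
    G j x (fun i => uEnv Ω (fun y => u y i) x) (gradient φ x) (hess φ x) ≤ 0 := by
  set c := uEnv Ω (fun y => u y j) x - φ x with hc
  have := hu j x hx _ (contDiff_add_quartic hφ x c 1) ⟨by simp [hc], ?_⟩
  · rwa [gradient_add_quartic hφ, hess_add_quartic hφ] at this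
  · obtain ⟨N, hN, hNo, hxN⟩ := eventually_nhds_iff.1 h
    refine ⟨N, hNo, hxN, fun y hy => ?_⟩
    have h1 := hN y hy.1.1
    have h2 : 0 < ‖y - x‖ := norm_pos_iff.2 (sub_ne_zero.2 hy.2)
    have h3 : 0 < (‖y - x‖ ^ 2) ^ 2 := by positivity
    simp only at h1 ⊢
    linarith

/-- The pointwise supremum of a bounded family of subsolutions is a subsolution. -/
lemma SysSub.of_isLUB [Fintype ι] (hΩ : IsOpen Ω) (hGc : SysContinuous Ω G) (hGq : SysQuasiMonotone Ω G)
    {S : Set (En n → ι → ℝ)} (hS : ∀ v ∈ S, SysSub Ω G v) {M : ℝ}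
    (hb : ∀ v ∈ S, ∀ x ∈ Ω, ∀ i, |v x i| ≤ M) {u : En n → ι → ℝ}
    (hub : ∀ x ∈ Ω, ∀ i, |u x i| ≤ M)
    (hu : ∀ x ∈ Ω, ∀ i, IsLUB ((fun v => v x i) '' S) (u x i)) : SysSub Ω G u := by
  classical
  rintro j x hx φ hφ ⟨hφx, N, hNo, hxN, hN⟩
  by_contra! hpos
  obtain ⟨ε, hε, hball⟩ := hGc.exists_ball hΩ j hx hφ _ isOpen_Ioi hpos
  have hφc := hφ.continuous
  have hub' : ∀ i, ∀ y ∈ Ω, |u y i| ≤ M := fun i y hy => hub y hy i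
  have hnear : ∀ᶠ y in 𝓝 x, y ∈ N ∧ y ∈ Ω ∧ dist y x < ε ∧ |φ y - φ x| < ε / 2 ∧
      ∀ i, uEnv Ω (fun y => u y i) y < uEnv Ω (fun y => u y i) x + ε := by
    have h1 : ∀ᶠ y in 𝓝 x, |φ y - φ x| < ε / 2 :=
      hφc.continuousAt.eventually (Metric.ball_mem_nhds (φ x) (half_pos hε))
    have h2 : ∀ᶠ y in 𝓝 x, ∀ i, uEnv Ω (fun y => u y i) y < uEnv Ω (fun y => u y i) x + ε :=
      eventually_all.2 fun i => eventually_uEnv_lt hΩ (hub' i) hx (by linarith)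
    filter_upwards [hNo.mem_nhds hxN, hΩ.mem_nhds hx, Metric.ball_mem_nhds x hε, h1, h2]
      with y a b c d e using ⟨a, b, c, d, e⟩
  obtain ⟨ρ, hρ, hρs⟩ := Metric.nhds_basis_closedBall.mem_iff.1 hnear
  have husc : ∀ v : En n → ℝ, (∀ y ∈ Ω, |v y| ≤ M) → ∀ K ⊆ Ω,
      UpperSemicontinuousOn (fun y => uEnv Ω v y - φ y) K := by
    intro v hv K hK y hy a ha
    refine Eventually.filter_mono nhdsWithin_le_nhds ?_
    obtain ⟨b, hb1, hb2⟩ := exists_between ha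
    have h1 := eventually_uEnv_lt hΩ hv (hK hy) (a := b + φ y) (by simp only at hb1; linarith)
    have h2 := hφc.continuousAt.eventually (lt_mem_nhds (show φ y - (a - b) < φ y by linarith))
    filter_upwards [h1, h2] with w hw1 hw2
    linarith
  have hsph : ∃ δ > 0, ∀ y ∈ Metric.sphere x ρ, uEnv Ω (fun y => u y j) y - φ y ≤ -δ := by
    rcases (Metric.sphere x ρ).eq_empty_or_nonempty with he | hne
    · exact ⟨1, one_pos, by simp [he]⟩
    · have hsub : Metric.sphere x ρ ⊆ Ω := fun y hy => (hρs (Metric.sphere_subset_closedBall hy)).2.1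
      obtain ⟨a, ha, hmax⟩ := (husc _ (hub' j) _ hsub).exists_isMaxOn hne (isCompact_sphere x ρ)
      refine ⟨φ a - uEnv Ω (fun y => u y j) a, ?_, fun y hy => by simpa using hmax hy⟩
      have hax : a ≠ x := by
        rintro rfl
        simp at ha
        exact hρ.ne ha
      exact sub_pos.2 (hN a ⟨⟨(hρs (Metric.sphere_subset_closedBall ha)).1, hsub ha⟩, hax⟩)
  obtain ⟨δ, hδ, hsph⟩ := hsph
  set δ' := min δ (ε / 2) with hδ'
  have hδ'0 : 0 < δ' := lt_min hδ (half_pos hε)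
  obtain ⟨y, hyu, hyρ, hyφ⟩ : ∃ y, uEnv Ω (fun y => u y j) x - δ' / 2 < u y j ∧
      y ∈ Metric.closedBall x ρ ∧ φ y < φ x + δ' / 2 := by
    have h1 : ∀ᶠ y in 𝓝 x, φ y < φ x + δ' / 2 :=
      hφc.continuousAt.eventually (gt_mem_nhds (by linarith))
    have h2 : ∀ᶠ y in 𝓝 x, y ∈ Metric.closedBall x ρ := Metric.closedBall_mem_nhds x hρ
    exact ((frequently_lt_of_lt_uEnv hΩ (hub' j) hx (by linarith)).and_eventually
      (h2.and h1)).exists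
  have hyΩ : y ∈ Ω := (hρs hyρ).2.1
  obtain ⟨_, ⟨v, hvS, rfl⟩, hvy⟩ := (lt_isLUB_iff (hu y hyΩ j)).1 hyu
  have hvb : ∀ i, ∀ y ∈ Ω, |v y i| ≤ M := fun i y hy => hb v hvS y hy i
  have hvu : ∀ i, ∀ y ∈ Ω, v y i ≤ u y i := fun i y hy => (hu y hy i).1 ⟨v, hvS, rfl⟩
  have hvu' : ∀ i, ∀ y ∈ Ω, uEnv Ω (fun y => v y i) y ≤ uEnv Ω (fun y => u y i) y :=
    fun i y hy => uEnv_mono hΩ (hvb i) (hub' i) (hvu i) hy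
  obtain ⟨a, ha, hmax⟩ := (husc _ (hvb j) _ fun y hy => (hρs hy).2.1).exists_isMaxOn
    ⟨x, Metric.mem_closedBall_self hρ.le⟩ (isCompact_closedBall x ρ)
  obtain ⟨haN, haΩ, haε, haφ, hau⟩ := hρs ha
  have hav : -δ' < uEnv Ω (fun y => v y j) a - φ a := by
    have h1 : uEnv Ω (fun y => v y j) y - φ y ≤ uEnv Ω (fun y => v y j) a - φ a := hmax hyρ
    have h2 := le_uEnv hΩ (hvb j) hyΩ
    simp only at hvy h2
    linarith
  have hav' : uEnv Ω (fun y => v y j) a ≤ φ a := by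
    refine (hvu' j a haΩ).trans ?_
    rcases eq_or_ne a x with rfl | hne
    · exact hφx.ge
    · exact (hN a ⟨⟨haN, haΩ⟩, hne⟩).le
  have hab : a ∈ Metric.ball x ρ := by
    refine lt_of_le_of_ne (Metric.mem_closedBall.1 ha) fun he => ?_
    have h1 := hsph a he
    have h2 := hvu' j a haΩ
    have h3 := min_le_left δ (ε / 2)
    linarith
  have hsol := (hS v hvS).le_zero_of_isLocalMax haΩ hφ
    (hmax.isLocalMax (mem_of_superset (Metric.isOpen_ball.mem_nhds hab)
      Metric.ball_subset_closedBall))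
  set r : ι → ℝ := fun i => uEnv Ω (fun y => v y i) a with hr
  set r' : ι → ℝ := fun i => if i = j then r i else max (r i) (uEnv Ω (fun y => u y i) x) with hr'
  have h1 := hGq j a haΩ r r' (gradient φ a) (hess φ a) (hess_isSymm hφ a)
    (fun i => by by_cases hi : i = j <;> simp [hr', hi]) (by simp [hr'])
  refine absurd (hball a haε r' fun i => ?_) (not_lt.2 (h1.trans hsol))
  by_cases hi : i = j
  · subst hi
    have h3 := min_le_right δ (ε / 2)
    have h4 := abs_lt.1 haφ
    simp only [hr', hr, if_true]
    rw [← hφx, abs_lt]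
    constructor <;> linarith
  · simp only [hr', if_neg hi]
    have h3 := hau i
    have h4 := hvu' i a haΩ
    rw [abs_of_nonneg (by simp), sub_lt_iff_lt_add', max_lt_iff]
    exact ⟨by simp only [hr]; linarith, by linarith⟩

/-- If a subsolution fails to be a supersolution at a point where it does not touch the upper
barrier `z`, it can be increased below `z` to a larger subsolution. -/
lemma SysSub.exists_bump [Fintype ι] (hΩ : IsOpen Ω) (hGc : SysContinuous Ω G) (hGe : SysElliptic Ω G)
    (hGq : SysQuasiMonotone Ω G) {M : ℝ} {u z : En n → ι → ℝ} (hu : SysSub Ω G u)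
    (hub : ∀ x ∈ Ω, ∀ i, |u x i| ≤ M) (hzb : ∀ x ∈ Ω, ∀ i, |z x i| ≤ M)
    (huz : ∀ x ∈ Ω, ∀ i, u x i ≤ z x i) {j : ι} {x : En n} (hx : x ∈ Ω) {φ : En n → ℝ}
    (hφ : ContDiff ℝ 2 φ) (ht : TouchBelow Ω φ (lEnv Ω fun y => u y j) x)
    (hneg : G j x (fun i => lEnv Ω (fun y => u y i) x) (gradient φ x) (hess φ x) < 0)
    (hgap : lEnv Ω (fun y => u y j) x < lEnv Ω (fun y => z y j) x) :
    ∃ U : En n → ι → ℝ, SysSub Ω G U ∧ (∀ y ∈ Ω, ∀ i, u y i ≤ U y i ∧ U y i ≤ z y i) ∧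
      ∃ y ∈ Ω, u y j < U y j := by
  classical
  obtain ⟨hφx, N, hNo, hxN, hN⟩ := ht
  have hub' : ∀ i, ∀ y ∈ Ω, |u y i| ≤ M := fun i y hy => hub y hy i
  have hzb' : ∀ i, ∀ y ∈ Ω, |z y i| ≤ M := fun i y hy => hzb y hy i
  set ψ : En n → ℝ := fun y => φ y + 0 + (-1) * (‖y - x‖ ^ 2) ^ 2 with hψdef
  have hψ : ContDiff ℝ 2 ψ := contDiff_add_quartic hφ x 0 (-1)
  have hψc := hψ.continuous
  have hψx : ψ x = lEnv Ω (fun y => u y j) x := by simp [hψdef, hφx]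
  rw [← gradient_add_quartic hφ x 0 (-1), ← hess_add_quartic hφ x 0 (-1)] at hneg
  obtain ⟨ε, hε, hball⟩ := hGc.exists_ball hΩ j hx hψ _ isOpen_Iio hneg
  set γ := lEnv Ω (fun y => z y j) x - lEnv Ω (fun y => u y j) x with hγ
  have hγ0 : 0 < γ := sub_pos.2 hgap
  have hnear : ∀ᶠ y in 𝓝 x, y ∈ N ∧ y ∈ Ω ∧ dist y x < ε ∧ |ψ y - ψ x| < ε / 2 ∧
      ψ y < ψ x + γ / 4 ∧ lEnv Ω (fun y => z y j) x - γ / 4 < z y j ∧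
      ∀ i, lEnv Ω (fun y => u y i) x - ε < u y i := by
    have h1 : ∀ᶠ y in 𝓝 x, |ψ y - ψ x| < ε / 2 :=
      hψc.continuousAt.eventually (Metric.ball_mem_nhds (ψ x) (half_pos hε))
    have h2 : ∀ᶠ y in 𝓝 x, ψ y < ψ x + γ / 4 :=
      hψc.continuousAt.eventually (gt_mem_nhds (by linarith))
    have h3 : ∀ᶠ y in 𝓝 x, lEnv Ω (fun y => z y j) x - γ / 4 < z y j :=
      eventually_lt_of_lt_lEnv hΩ (hzb' j) hx (by linarith)
    have h4 : ∀ᶠ y in 𝓝 x, ∀ i, lEnv Ω (fun y => u y i) x - ε < u y i :=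
      eventually_all.2 fun i => eventually_lt_of_lt_lEnv hΩ (hub' i) hx (by linarith)
    filter_upwards [hNo.mem_nhds hxN, hΩ.mem_nhds hx, Metric.ball_mem_nhds x hε, h1, h2, h3, h4]
      with y a b c d e f g using ⟨a, b, c, d, e, f, g⟩
  obtain ⟨ρ, hρ, hρs⟩ := Metric.nhds_basis_ball.mem_iff.1 hnear
  obtain ⟨δ, hδ, hδε, hδγ, hδρ⟩ :
      ∃ δ > 0, δ < ε / 2 ∧ δ < γ / 4 ∧ δ < ((ρ / 2) ^ 2) ^ 2 := by
    obtain ⟨δ, hδ, h⟩ := exists_between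
      (show 0 < min (ε / 2) (min (γ / 4) (((ρ / 2) ^ 2) ^ 2)) by positivity)
    rw [lt_min_iff, lt_min_iff] at h
    exact ⟨δ, hδ, h⟩
  set U : En n → ι → ℝ := fun y i =>
    if i = j ∧ dist y x < ρ then max (u y i) (ψ y + δ) else u y i with hU
  have huU : ∀ y ∈ Ω, ∀ i, u y i ≤ U y i := by
    intro y _ i
    simp only [hU]
    split_ifs
    · exact le_max_left _ _
    · exact le_rfl
  have hUz : ∀ y ∈ Ω, ∀ i, U y i ≤ z y i := by
    intro y hy i
    simp only [hU]
    split_ifs with h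
    · obtain ⟨-, -, -, -, h1, h2, -⟩ := hρs h.2
      rw [h.1]
      refine max_le (huz y hy j) ?_
      linarith
    · exact huz y hy i
  have hUb : ∀ i, ∀ y ∈ Ω, |U y i| ≤ M := fun i y hy => abs_le.2
    ⟨(abs_le.1 (hub y hy i)).1.trans (huU y hy i),
      (hUz y hy i).trans (abs_le.1 (hzb y hy i)).2⟩
  have huU' : ∀ i, ∀ y ∈ Ω, uEnv Ω (fun y => u y i) y ≤ uEnv Ω (fun y => U y i) y :=
    fun i y hy => uEnv_mono hΩ (hub' i) (hUb i) (fun y hy => huU y hy i) hy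
  have hUne : ∀ i, i ≠ j → ∀ y, U y i = u y i := fun i hi y => by simp [hU, hi]
  have hfar : ∀ y, ρ / 2 < dist y x → U y j = u y j := by
    intro y hy
    by_cases h : dist y x < ρ
    · obtain ⟨h1, h2, -⟩ := hρs h
      have hne : y ≠ x := dist_pos.1 ((half_pos hρ).trans hy)
      have h3 := (hN y ⟨⟨h1, h2⟩, hne⟩).le.trans (lEnv_le hΩ (hub' j) h2)
      have h4 : ((ρ / 2) ^ 2) ^ 2 ≤ (‖y - x‖ ^ 2) ^ 2 := by
        rw [← dist_eq_norm]
        gcongr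
      simp only [hU, h, and_self, if_true]
      refine max_eq_left ?_
      simp only [hψdef] at *
      linarith
    · simp [hU, h]
  have hnearU : ∀ y, dist y x < ρ → ∀ᶠ y' in 𝓝 y, U y' j = max (u y' j) (ψ y' + δ) := by
    intro y hy
    filter_upwards [Metric.isOpen_ball.mem_nhds hy] with y' hy'
    have : dist y' x < ρ := hy'
    simp [hU, this]
  have henv : ∀ k, ∀ y ∈ Ω, uEnv Ω (fun y => U y k) y = uEnv Ω (fun y => u y k) y ∨
      (k = j ∧ dist y x < ρ ∧ uEnv Ω (fun y => U y j) y = ψ y + δ) := by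
    intro k y hy
    by_cases hk : k = j
    · subst hk
      rcases lt_or_ge (dist y x) ρ with h | h
      · have h1 : uEnv Ω (fun y => U y k) y = max (uEnv Ω (fun y => u y k) y) (ψ y + δ) := by
          rw [uEnv_congr hΩ hy (hnearU y h)]
          exact uEnv_max hΩ (hub' k) hy (hψc.add continuous_const).continuousAt
        rcases max_choice (uEnv Ω (fun y => u y k) y) (ψ y + δ) with h2 | h2
        · exact .inl (h1.trans h2)
        · exact .inr ⟨rfl, h, h1.trans h2⟩
      · refine .inl (uEnv_congr hΩ hy ?_)
        have : ∀ᶠ y' in 𝓝 y, ρ / 2 < dist y' x :=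
          (continuous_id.dist continuous_const).continuousAt.eventually
            (lt_mem_nhds (by simp only [id]; linarith))
        filter_upwards [this] with y' hy' using hfar y' hy'
    · exact .inl (by simp only [hUne k hk])
  refine ⟨U, ?_, fun y hy i => ⟨huU y hy i, hUz y hy i⟩, ?_⟩
  · rintro k y hy ξ hξ ⟨hξy, N', hN'o, hyN', hN'⟩
    rcases henv k y hy with h | ⟨rfl, hyρ, h⟩
    · have h1 := hu k y hy ξ hξ ⟨hξy.trans h, N', hN'o, hyN', fun y' hy' =>
        (huU' k y' hy'.1.2).trans_lt (hN' y' hy')⟩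
      exact (hGq k y hy _ _ _ _ (hess_isSymm hξ y) (fun i => huU' i y hy) h.symm).trans h1
    · have hmin : IsLocalMin (fun y' => ξ y' - ψ y') y := by
        filter_upwards [hnearU y hyρ, hN'o.mem_nhds hyN', hΩ.mem_nhds hy] with y' h1 h2 h3
        have h4 : ψ y' + δ ≤ uEnv Ω (fun y => U y k) y' :=
          ((le_max_right _ _).trans h1.ge).trans (le_uEnv hΩ (hUb k) h3)
        have h5 : uEnv Ω (fun y => U y k) y' ≤ ξ y' := by
          rcases eq_or_ne y' y with rfl | hne
          · exact hξy.ge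
          · exact (hN' y' ⟨⟨h2, h3⟩, hne⟩).le
        linarith
      obtain ⟨-, -, hyε, hyψ, -, -, hyu⟩ := hρs hyρ
      rw [gradient_eq_of_isLocalMin_sub hψ hξ hmin]
      refine (hGe k y hy _ _ _ _ (hess_isSymm hψ y) (hess_isSymm hξ y)
        (hess_loewnerLE_of_isLocalMin_sub hψ hξ hmin)).trans ?_
      set r : ι → ℝ := fun i => uEnv Ω (fun y => U y i) y with hr
      set r' : ι → ℝ := fun i =>
        if i = k then r i else min (r i) (lEnv Ω (fun y => u y i) x) with hr'
      refine (hGq k y hy r' r _ _ (hess_isSymm hψ y)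
        (fun i => by by_cases hi : i = k <;> simp [hr', hi]) (by simp [hr'])).trans
        (le_of_lt (hball y hyε r' fun i => ?_))
      by_cases hi : i = k
      · subst hi
        have h4 := abs_lt.1 hyψ
        simp only [hr', if_true, hr, h, ← hψx]
        rw [abs_lt]
        constructor <;> linarith
      · have h3 := hyu i
        have h4 : u y i ≤ r i := (huU y hy i).trans (le_uEnv hΩ (hUb i) hy)
        simp only [hr', if_neg hi]
        rw [abs_sub_comm, abs_of_nonneg (by simp), sub_lt_comm, lt_min_iff]
        exact ⟨by linarith, by linarith⟩
  · have h1 : ∃ᶠ y in 𝓝 x, u y j < lEnv Ω (fun y => u y j) x + δ / 2 :=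
      frequently_lt_of_lEnv_lt hΩ (hub' j) hx (by linarith)
    have h2 : ∀ᶠ y in 𝓝 x, ψ x - δ / 2 < ψ y :=
      hψc.continuousAt.eventually (lt_mem_nhds (by linarith))
    have hxΩ : ∀ᶠ y in 𝓝 x, y ∈ Ω := hΩ.mem_nhds hx
    obtain ⟨y, h3, h4, h5, h6⟩ := (h1.and_eventually
      (h2.and (hxΩ.and (hnearU x (by simpa using hρ))))).exists
    refine ⟨y, h5, ?_⟩
    rw [h6]
    exact lt_max_of_lt_right (by linarith)

/-- Perron's method for quasi-monotone systems. -/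
theorem SysSub.exists_solution [Fintype ι] (hΩ : IsOpen Ω) (hGc : SysContinuous Ω G)
    (hGe : SysElliptic Ω G) (hGq : SysQuasiMonotone Ω G) {M : ℝ} {w z : En n → ι → ℝ}
    (hw : SysSub Ω G w) (hz : SysSuper Ω G z) (hwb : ∀ x ∈ Ω, ∀ i, |w x i| ≤ M)
    (hzb : ∀ x ∈ Ω, ∀ i, |z x i| ≤ M) (hwz : ∀ x ∈ Ω, ∀ i, w x i ≤ z x i) :
    ∃ u : En n → ι → ℝ, SysSub Ω G u ∧ SysSuper Ω G u ∧
      ∀ x ∈ Ω, ∀ i, w x i ≤ u x i ∧ u x i ≤ z x i := by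
  set S : Set (En n → ι → ℝ) :=
    {v | SysSub Ω G v ∧ ∀ x ∈ Ω, ∀ i, w x i ≤ v x i ∧ v x i ≤ z x i} with hS
  have hwS : w ∈ S := ⟨hw, fun x hx i => ⟨le_rfl, hwz x hx i⟩⟩
  have hbetween : ∀ v : En n → ι → ℝ, (∀ x ∈ Ω, ∀ i, w x i ≤ v x i ∧ v x i ≤ z x i) →
      ∀ x ∈ Ω, ∀ i, |v x i| ≤ M := fun v hv x hx i => abs_le.2
    ⟨(abs_le.1 (hwb x hx i)).1.trans (hv x hx i).1,
      (hv x hx i).2.trans (abs_le.1 (hzb x hx i)).2⟩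
  set u : En n → ι → ℝ := fun x i => sSup ((fun v => v x i) '' S) with hu
  have hlub : ∀ x ∈ Ω, ∀ i, IsLUB ((fun v => v x i) '' S) (u x i) := fun x hx i =>
    isLUB_csSup ⟨_, w, hwS, rfl⟩ ⟨z x i, by rintro _ ⟨v, hv, rfl⟩; exact (hv.2 x hx i).2⟩
  have hwu : ∀ x ∈ Ω, ∀ i, w x i ≤ u x i ∧ u x i ≤ z x i := fun x hx i =>
    ⟨(hlub x hx i).1 ⟨w, hwS, rfl⟩,
      (hlub x hx i).2 (by rintro _ ⟨v, hv, rfl⟩; exact (hv.2 x hx i).2)⟩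
  have hub := hbetween u hwu
  have husub : SysSub Ω G u := SysSub.of_isLUB hΩ hGc hGq (fun v hv => hv.1)
    (fun v hv => hbetween v hv.2) hub hlub
  refine ⟨u, husub, ?_, hwu⟩
  intro j x hx φ hφ ht
  by_contra! hneg
  have hle : ∀ i, ∀ y ∈ Ω, lEnv Ω (fun y => u y i) y ≤ lEnv Ω (fun y => z y i) y :=
    fun i y hy => lEnv_mono hΩ (fun y hy => hub y hy i) (fun y hy => hzb y hy i)
      (fun y hy => (hwu y hy i).2) hy
  rcases (hle j x hx).lt_or_eq with hlt | heq
  · obtain ⟨U, hU, hUu, y, hy, hlt⟩ := husub.exists_bump hΩ hGc hGe hGq hub hzb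
      (fun y hy i => (hwu y hy i).2) hx hφ ht hneg hlt
    exact hlt.not_ge ((hlub y hy j).1
      ⟨U, ⟨hU, fun y hy i => ⟨(hwu y hy i).1.trans (hUu y hy i).1, (hUu y hy i).2⟩⟩, rfl⟩)
  · obtain ⟨hφx, N, hNo, hxN, hN⟩ := ht
    have h1 := hz j x hx φ hφ ⟨hφx.trans heq, N, hNo, hxN, fun y hy =>
      (hN y hy).trans_le (hle j y hy.1.2)⟩
    exact hneg.not_ge (h1.trans (hGq j x hx _ _ _ _ (hess_isSymm hφ x)
      (fun i => hle i x hx) heq))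

end System

section Balanced

variable {n m₁ m₂ : ℕ} {Ω : Set (En n)} {F1 : Fin m₁ → Op n m₁ m₂} {F2 : Fin m₂ → Op n m₁ m₂}

/-- The change of unknown `u₂ ↦ -u₂` turns a balanced system into a quasi-monotone one. -/
def balancedSystem (F1 : Fin m₁ → Op n m₁ m₂) (F2 : Fin m₂ → Op n m₁ m₂) :
    Fin m₁ ⊕ Fin m₂ → En n → (Fin m₁ ⊕ Fin m₂ → ℝ) → En n → Symn n → ℝ
  | .inl j => fun x r p X => F1 j x (fun i => r (.inl i)) (fun i => -r (.inr i)) p X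
  | .inr j => fun x r p X => -F2 j x (fun i => r (.inl i)) (fun i => -r (.inr i)) (-p) (-X)

/-- The unknown of the quasi-monotone system attached to a balanced system. -/
def joinNeg (u1 : En n → Fin m₁ → ℝ) (u2 : En n → Fin m₂ → ℝ) : En n → Fin m₁ ⊕ Fin m₂ → ℝ :=
  fun x => Sum.elim (u1 x) fun i => -u2 x i

lemma touchBelow_neg {φ f : En n → ℝ} {x : En n} :
    TouchBelow Ω (fun y => -φ y) (fun y => -f y) x ↔ TouchAbove Ω φ f x := by
  simp [TouchBelow, TouchAbove]

lemma touchAbove_neg {φ f : En n → ℝ} {x : En n} :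
    TouchAbove Ω (fun y => -φ y) (fun y => -f y) x ↔ TouchBelow Ω φ f x := by
  simp [TouchBelow, TouchAbove]

lemma sysSuper_joinNeg_iff {u1 : En n → Fin m₁ → ℝ} {u2 : En n → Fin m₂ → ℝ}
    (h1 : BddOn Ω u1) (h2 : BddOn Ω u2) :
    SysSuper Ω (balancedSystem F1 F2) (joinNeg u1 u2) ↔ SuperSub Ω F1 F2 u1 u2 := by
  have hneg : ∀ f : En n → ℝ, (lEnv Ω fun y => -f y) = fun y => -uEnv Ω f y := fun f => by
    ext1 x; simp [lEnv_eq_neg_uEnv]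
  simp only [SuperSub, h1, h2, true_and, SysSuper, Sum.forall, balancedSystem, joinNeg,
    Sum.elim_inl, Sum.elim_inr, hneg, neg_neg]
  refine and_congr_right fun _ => forall₃_congr fun j x hx => ⟨fun h φ hφ ht => ?_,
    fun h φ hφ ht => ?_⟩
  · have := h (fun y => -φ y) hφ.neg (touchBelow_neg.2 ht)
    simpa [gradient_neg_fun, hess_neg_fun] using this
  · have := h (fun y => -φ y) hφ.neg (touchBelow_neg.1 (by simpa using ht))
    simpa [gradient_neg_fun, hess_neg_fun] using this

lemma sysSub_joinNeg_iff {u1 : En n → Fin m₁ → ℝ} {u2 : En n → Fin m₂ → ℝ}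
    (h1 : BddOn Ω u1) (h2 : BddOn Ω u2) :
    SysSub Ω (balancedSystem F1 F2) (joinNeg u1 u2) ↔ SubSuper Ω F1 F2 u1 u2 := by
  have hneg : ∀ f : En n → ℝ, (uEnv Ω fun y => -f y) = fun y => -lEnv Ω f y := fun f => by
    ext1 x; simp [lEnv_eq_neg_uEnv]
  simp only [SubSuper, h1, h2, true_and, SysSub, Sum.forall, balancedSystem, joinNeg,
    Sum.elim_inl, Sum.elim_inr, hneg, neg_neg]
  refine and_congr_right fun _ => forall₃_congr fun j x hx => ⟨fun h φ hφ ht => ?_,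
    fun h φ hφ ht => ?_⟩
  · have := h (fun y => -φ y) hφ.neg (touchAbove_neg.2 ht)
    simpa [gradient_neg_fun, hess_neg_fun] using this
  · have := h (fun y => -φ y) hφ.neg (touchAbove_neg.1 (by simpa using ht))
    simpa [gradient_neg_fun, hess_neg_fun] using this

lemma sysContinuous_balancedSystem (h1 : ∀ j, OpContinuousOn Ω (F1 j))
    (h2 : ∀ j, OpContinuousOn Ω (F2 j)) : SysContinuous Ω (balancedSystem F1 F2) := by
  rintro (j | j)
  · exact (h1 j).comp (f := fun q : En n × (Fin m₁ ⊕ Fin m₂ → ℝ) × En n × Symn n =>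
      (q.1, (fun i => q.2.1 (.inl i)), (fun i => -q.2.1 (.inr i)), q.2.2.1, q.2.2.2))
      (by fun_prop) fun q hq => ⟨hq.1, trivial⟩
  · exact ((h2 j).comp (f := fun q : En n × (Fin m₁ ⊕ Fin m₂ → ℝ) × En n × Symn n =>
      (q.1, (fun i => q.2.1 (.inl i)), (fun i => -q.2.1 (.inr i)), -q.2.2.1, -q.2.2.2))
      (by fun_prop) fun q hq => ⟨hq.1, trivial⟩).neg

lemma sysElliptic_balancedSystem (h1 : ∀ j, DegElliptic Ω (F1 j))
    (h2 : ∀ j, DegElliptic Ω (F2 j)) : SysElliptic Ω (balancedSystem F1 F2) := by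
  rintro (j | j) x hx r p X Y hX hY hXY
  · exact h1 j x hx _ _ _ _ _ hX hY hXY
  · refine neg_le_neg (h2 j x hx _ _ _ _ _ hY.neg hX.neg ?_)
    simpa [LoewnerLE, sub_eq_add_neg, add_comm] using hXY

lemma sysQuasiMonotone_balancedSystem (h : BalancedQM Ω F1 F2) :
    SysQuasiMonotone Ω (balancedSystem F1 F2) := by
  obtain ⟨hs1, hr1, hr2, hs2⟩ := h
  rintro (j | j) x hx r ρ p X hX hle heq
  · exact (hs1 j x hx _ _ _ _ _ hX fun i => neg_le_neg (hle (.inr i))).trans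
      (hr1 j x hx _ _ _ _ _ hX (fun i => hle (.inl i)) heq)
  · exact neg_le_neg ((hr2 j x hx _ _ _ _ _ hX.neg fun i => hle (.inl i)).trans
      (hs2 j x hx _ _ _ _ _ hX.neg (fun i => neg_le_neg (hle (.inr i))) (by simp [heq])))

lemma exists_abs_joinNeg_le {u1 : En n → Fin m₁ → ℝ} {u2 : En n → Fin m₂ → ℝ}
    (h1 : BddOn Ω u1) (h2 : BddOn Ω u2) : ∃ M, ∀ x ∈ Ω, ∀ i, |joinNeg u1 u2 x i| ≤ M := by
  obtain ⟨M1, h1⟩ := h1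
  obtain ⟨M2, h2⟩ := h2
  refine ⟨max M1 M2, ?_⟩
  rintro x hx (i | i)
  · exact (h1 x hx i).trans (le_max_left _ _)
  · simpa [joinNeg] using .inr (h2 x hx i)

lemma BddOn.of_between {m : ℕ} {a b u : En n → Fin m → ℝ} (ha : BddOn Ω a) (hb : BddOn Ω b)
    (h : ∀ x ∈ Ω, ∀ i, a x i ≤ u x i ∧ u x i ≤ b x i) : BddOn Ω u := by
  obtain ⟨A, hA⟩ := ha
  obtain ⟨B, hB⟩ := hb
  exact ⟨max A B, fun x hx i => (abs_le_max_abs_abs (h x hx i).1 (h x hx i).2).trans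
    (max_le_max (hA x hx i) (hB x hx i))⟩

end Balanced

/-- Existence, Perron's method: if there exist a bounded super-sub solution
(z1, z2) and a bounded sub-super solution (w1, w2) with z1 ≥ w1 and z2 ≤ w2 in Ω, then
there exists a solution (u1, u2) (i.e. both a super-sub and a sub-super solution) with
z1 ≥ u1 ≥ w1 and z2 ≤ u2 ≤ w2 in Ω. -/
theorem perron_existence {n m₁ m₂ : ℕ} (hm₁ : 1 ≤ m₁)
    (Ω : Set (En n)) (hΩo : IsOpen Ω) (hΩb : IsBounded Ω)
    (F1 : Fin m₁ → Op n m₁ m₂) (F2 : Fin m₂ → Op n m₁ m₂)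
    (hF1c : ∀ j, OpContinuousOn Ω (F1 j)) (hF2c : ∀ j, OpContinuousOn Ω (F2 j))
    (hF1e : ∀ j, DegElliptic Ω (F1 j)) (hF2e : ∀ j, DegElliptic Ω (F2 j))
    (hQM : BalancedQM Ω F1 F2)
    (z1 w1 : En n → Fin m₁ → ℝ) (z2 w2 : En n → Fin m₂ → ℝ)
    (hz : SuperSub Ω F1 F2 z1 z2) (hw : SubSuper Ω F1 F2 w1 w2)
    (hzw1 : ∀ x ∈ Ω, ∀ j, w1 x j ≤ z1 x j)
    (hzw2 : ∀ x ∈ Ω, ∀ j, z2 x j ≤ w2 x j) :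
    ∃ (u1 : En n → Fin m₁ → ℝ) (u2 : En n → Fin m₂ → ℝ),
      SuperSub Ω F1 F2 u1 u2 ∧ SubSuper Ω F1 F2 u1 u2 ∧
      (∀ x ∈ Ω, ∀ j, w1 x j ≤ u1 x j ∧ u1 x j ≤ z1 x j) ∧
      (∀ x ∈ Ω, ∀ j, z2 x j ≤ u2 x j ∧ u2 x j ≤ w2 x j) := by
  obtain ⟨Mz, hMz⟩ := exists_abs_joinNeg_le hz.1 hz.2.1
  obtain ⟨Mw, hMw⟩ := exists_abs_joinNeg_le hw.1 hw.2.1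
  obtain ⟨u, husub, husuper, hu⟩ := SysSub.exists_solution (M := max Mz Mw) hΩo
    (sysContinuous_balancedSystem hF1c hF2c) (sysElliptic_balancedSystem hF1e hF2e)
    (sysQuasiMonotone_balancedSystem hQM) ((sysSub_joinNeg_iff hw.1 hw.2.1).2 hw)
    ((sysSuper_joinNeg_iff hz.1 hz.2.1).2 hz)
    (fun x hx i => (hMw x hx i).trans (le_max_right _ _))
    (fun x hx i => (hMz x hx i).trans (le_max_left _ _))
    (by rintro x hx (i | i)
        · exact hzw1 x hx i
        · exact neg_le_neg (hzw2 x hx i))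
  obtain ⟨u1, u2, rfl⟩ : ∃ u1 u2, u = joinNeg u1 u2 :=
    ⟨fun x i => u x (.inl i), fun x i => -u x (.inr i), by
      ext x (i | i) <;> simp [joinNeg]⟩
  have h1 : ∀ x ∈ Ω, ∀ j, w1 x j ≤ u1 x j ∧ u1 x j ≤ z1 x j := fun x hx j => hu x hx (.inl j)
  have h2 : ∀ x ∈ Ω, ∀ j, z2 x j ≤ u2 x j ∧ u2 x j ≤ w2 x j := fun x hx j =>
    ⟨neg_le_neg_iff.1 (hu x hx (.inr j)).2, neg_le_neg_iff.1 (hu x hx (.inr j)).1⟩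
  have hb1 := hw.1.of_between hz.1 h1
  have hb2 := hz.2.1.of_between hw.2.1 h2
  exact ⟨u1, u2, (sysSuper_joinNeg_iff hb1 hb2).1 husuper, (sysSub_joinNeg_iff hb1 hb2).1 husub,
    h1, h2⟩
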